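/- There exist constants C>0 and c>0 such that for all x,y ∈ ℝ²₊ and all t>0, the kernel W*(x,y,t) = Γ(x−y*,t) + 4∫₀^{y₂}∫_ℝ Γ(x−z*,t) ∂²_{z₁}E(z−y) dz₁ dz₂ satisfies the pointwise bound |W*(x,y,t)| ≤ C e^{−c x₂²/t} / (|x−y*|² + t). -/

import Mathlib

open MeasureTheory Real
open scoped ENNReal

noncomputable section

/-- The open upper half plane ℝ²₊ = {x : x₂ > 0}. -/
def upperHalf : Set (ℝ × ℝ) := {x | 0 < x.2}

/-- 2D heat kernel Γ(x,t) = (4πt)⁻¹ exp(−|x|²/(4t)). -/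
def heatK (x : ℝ × ℝ) (t : ℝ) : ℝ :=
  (4 * π * t)⁻¹ * Real.exp (-(x.1 ^ 2 + x.2 ^ 2) / (4 * t))

/-- 1D heat kernel Γ₀(r,t) = (4πt)^{-1/2} exp(−r²/(4t)). -/
def heatK1 (r t : ℝ) : ℝ :=
  (Real.sqrt (4 * π * t))⁻¹ * Real.exp (-r ^ 2 / (4 * t))

/-- ∂²_{z₁} E(z) = (z₁² − z₂²)/(2π|z|⁴), for E(z) = −(2π)⁻¹ log|z|. -/
def d2E (z : ℝ × ℝ) : ℝ :=
  (z.1 ^ 2 - z.2 ^ 2) / (2 * π * (z.1 ^ 2 + z.2 ^ 2) ^ 2)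

/-- Poisson kernel P_s(r) = s/(π(r²+s²)). -/
def Pker (s r : ℝ) : ℝ := s / (π * (r ^ 2 + s ^ 2))

/-- Conjugate Poisson kernel Q_s(r) = r/(π(r²+s²)). -/
def Qker (s r : ℝ) : ℝ := r / (π * (r ^ 2 + s ^ 2))

/-- ∇⊥E(z) = (∂₂E(z), −∂₁E(z)) for E(z) = −(2π)⁻¹ log|z|. -/
def gradPerpE (z : ℝ × ℝ) : ℝ × ℝ :=
  (-z.2 / (2 * π * (z.1 ^ 2 + z.2 ^ 2)), z.1 / (2 * π * (z.1 ^ 2 + z.2 ^ 2)))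

/-- The Biot–Savart kernel ∇⊥_x D(x,y) = ∇⊥E(x−y) − ∇⊥E(x−y*). -/
def bsKernel (x y : ℝ × ℝ) : ℝ × ℝ :=
  gradPerpE (x.1 - y.1, x.2 - y.2) - gradPerpE (x.1 - y.1, x.2 + y.2)

/-- Integral of a real function against a finite signed measure (via Jordan decomposition). -/
def sInt (μ : SignedMeasure (ℝ × ℝ)) (f : ℝ × ℝ → ℝ) : ℝ :=
  (∫ y, f y ∂μ.toJordanDecomposition.posPart) - ∫ y, f y ∂μ.toJordanDecomposition.negPart

/-- Integral of a vector-valued function against a finite signed measure. -/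
def sIntV (μ : SignedMeasure (ℝ × ℝ)) (f : ℝ × ℝ → ℝ × ℝ) : ℝ × ℝ :=
  (∫ y, f y ∂μ.toJordanDecomposition.posPart) - ∫ y, f y ∂μ.toJordanDecomposition.negPart

/-- Total variation norm ‖μ‖_M of a finite signed measure. -/
def normM (μ : SignedMeasure (ℝ × ℝ)) : ℝ := (μ.totalVariation Set.univ).toReal

/-- The vorticity kernel W(x,y,t). -/
def Wk (x y : ℝ × ℝ) (t : ℝ) : ℝ :=
  heatK (x.1 - y.1, x.2 - y.2) t + heatK (x.1 - y.1, x.2 + y.2) t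
    + 4 * ∫ z₂ in (0:ℝ)..y.2, ∫ z₁ : ℝ, heatK (x.1 - z₁, x.2 + z₂) t * d2E (z₁ - y.1, z₂ - y.2)
    - 2 * heatK1 x.2 t * ∫ z₁ : ℝ, heatK1 (x.1 - z₁) t * Pker y.2 (z₁ - y.1)

/-- T(t)ω₀(x) = ∫ W(x,y,t) dω₀(y) for a finite signed measure ω₀. -/
def Tsg (ω₀ : SignedMeasure (ℝ × ℝ)) (t : ℝ) (x : ℝ × ℝ) : ℝ :=
  sInt ω₀ (fun y => Wk x y t)

/-- The boundary trace operator T₁μ(x₁) = π⁻¹ ∫ y₂/((x₁−y₁)²+y₂²) dμ(y). -/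
def T1op (μ : SignedMeasure (ℝ × ℝ)) (x₁ : ℝ) : ℝ :=
  π⁻¹ * sInt μ (fun y => y.2 / ((x₁ - y.1) ^ 2 + y.2 ^ 2))

/-- W*(x,y,t) = Γ(x−y*,t) + 4∫₀^{y₂}∫_ℝ Γ(x−z*,t) ∂²_{z₁}E(z−y) dz. -/
def Wstar (x y : ℝ × ℝ) (t : ℝ) : ℝ :=
  heatK (x.1 - y.1, x.2 + y.2) t
    + 4 * ∫ z₂ in (0:ℝ)..y.2, ∫ z₁ : ℝ, heatK (x.1 - z₁, x.2 + z₂) t * d2E (z₁ - y.1, z₂ - y.2)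

/-- A quadratic weight is absorbed by half of the Gaussian exponent. -/
lemma one_add_mul_exp_neg_le (q : ℝ) :
    (1 + q) * Real.exp (-q / 4) ≤ 8 * Real.exp (-q / 8) := by
  have h1 : 1 + q ≤ 8 * Real.exp (q / 8) := by
    have := Real.add_one_le_exp (q / 8)
    linarith
  calc (1 + q) * Real.exp (-q / 4) ≤ 8 * Real.exp (q / 8) * Real.exp (-q / 4) := by gcongr
    _ = 8 * Real.exp (-q / 8) := by
      rw [mul_assoc, ← Real.exp_add]
      ring_nf

lemma abs_d2E_le (u s : ℝ) : |d2E (u, s)| ≤ (u ^ 2 + s ^ 2)⁻¹ := by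
  unfold d2E
  dsimp only
  rcases (add_nonneg (sq_nonneg u) (sq_nonneg s)).eq_or_lt with h | h
  · rw [← h]; simp
  · rw [abs_div, abs_of_pos (a := 2 * π * (u ^ 2 + s ^ 2) ^ 2) (by positivity),
      div_le_iff₀ (by positivity)]
    have h1 : |u ^ 2 - s ^ 2| ≤ u ^ 2 + s ^ 2 :=
      abs_le.mpr ⟨by nlinarith [sq_nonneg u], by nlinarith [sq_nonneg s]⟩
    have h2 : (u ^ 2 + s ^ 2)⁻¹ * (2 * π * (u ^ 2 + s ^ 2) ^ 2) = 2 * π * (u ^ 2 + s ^ 2) := by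
      field_simp
    rw [h2]
    nlinarith [Real.pi_gt_three]

lemma d2E_neg_left (u s : ℝ) : d2E (-u, s) = d2E (u, s) := by
  simp [d2E]

lemma continuous_d2E_left {s : ℝ} (hs : s ≠ 0) : Continuous fun u : ℝ => d2E (u, s) := by
  unfold d2E
  have : ∀ u : ℝ, 2 * π * (u ^ 2 + s ^ 2) ^ 2 ≠ 0 := fun u => by positivity
  dsimp only
  fun_prop (disch := assumption)

lemma integrable_d2E_left {s : ℝ} (hs : s ≠ 0) : Integrable fun u : ℝ => d2E (u, s) := by
  refine (integrable_inv_one_add_sq.const_mul (1 + 1 / s ^ 2)).mono'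
    (continuous_d2E_left hs).aestronglyMeasurable (ae_of_all _ fun u => ?_)
  refine (abs_d2E_le u s).trans ?_
  have hs2 : 0 < s ^ 2 := by positivity
  rw [← div_eq_mul_inv, le_div_iff₀ (by positivity), inv_mul_le_iff₀ (by positivity)]
  have : (u ^ 2 + s ^ 2) * (1 + 1 / s ^ 2) = u ^ 2 + s ^ 2 + u ^ 2 / s ^ 2 + 1 := by
    field_simp
    ring
  rw [this]
  have : 0 ≤ u ^ 2 / s ^ 2 := by positivity
  linarith

lemma tendsto_div_sq_add_sq {s : ℝ} (l : Filter ℝ)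
    (hl : Filter.Tendsto (fun u : ℝ => u⁻¹) l (nhds 0)) :
    Filter.Tendsto (fun u : ℝ => -u / (2 * π * (u ^ 2 + s ^ 2))) l (nhds 0) := by
  refine squeeze_zero_norm (a := fun u => |u⁻¹|) (fun u => ?_) (by simpa using hl.abs)
  rcases eq_or_ne u 0 with rfl | hu
  · simp
  · have hu2 : 0 < u ^ 2 := by positivity
    rw [Real.norm_eq_abs, abs_div, abs_neg, abs_inv,
      abs_of_pos (a := 2 * π * (u ^ 2 + s ^ 2)) (by positivity),
      div_le_iff₀ (by positivity), inv_mul_eq_div, le_div_iff₀ (abs_pos.mpr hu), ← sq, sq_abs]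
    nlinarith [Real.pi_gt_three, sq_nonneg s]

lemma integral_d2E_left {s : ℝ} (hs : s ≠ 0) : ∫ u : ℝ, d2E (u, s) = 0 := by
  have h := integral_of_hasDerivAt_of_tendsto
    (f := fun u : ℝ => -u / (2 * π * (u ^ 2 + s ^ 2))) (f' := fun u => d2E (u, s))
    (m := 0) (n := 0) (fun u => ?_) (integrable_d2E_left hs)
    (tendsto_div_sq_add_sq _ tendsto_inv_atBot_zero)
    (tendsto_div_sq_add_sq _ tendsto_inv_atTop_zero)
  · simpa using h
  · have hne : 2 * π * (u ^ 2 + s ^ 2) ≠ 0 := by positivity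
    have h1 : HasDerivAt (fun u : ℝ => 2 * π * (u ^ 2 + s ^ 2)) (2 * π * (2 * u)) u := by
      simpa using ((hasDerivAt_pow 2 u).add_const (s ^ 2)).const_mul (2 * π)
    refine ((hasDerivAt_neg u).div h1 hne).congr_deriv ?_
    unfold d2E
    field_simp
    ring

lemma abs_exp_second_difference_le (a : ℝ) {u : ℝ} (hu : u ^ 2 ≤ 1) :
    (1 + a ^ 2) * |Real.exp (-(a - u) ^ 2 / 4) + Real.exp (-(a + u) ^ 2 / 4)
      - 2 * Real.exp (-a ^ 2 / 4)| ≤ 512 * u ^ 2 := by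
  have hD : Real.exp (-(a - u) ^ 2 / 4) + Real.exp (-(a + u) ^ 2 / 4)
      - 2 * Real.exp (-a ^ 2 / 4)
      = 2 * Real.exp (-a ^ 2 / 4) * (Real.exp (-u ^ 2 / 4) * Real.cosh (a * u / 2) - 1) := by
    have h1 : Real.exp (-(a - u) ^ 2 / 4)
        = Real.exp (-a ^ 2 / 4) * Real.exp (-u ^ 2 / 4) * Real.exp (a * u / 2) := by
      rw [← Real.exp_add, ← Real.exp_add]; ring_nf
    have h2 : Real.exp (-(a + u) ^ 2 / 4)
        = Real.exp (-a ^ 2 / 4) * Real.exp (-u ^ 2 / 4) * Real.exp (-(a * u / 2)) := by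
      rw [← Real.exp_add, ← Real.exp_add]; ring_nf
    rw [h1, h2, Real.cosh_eq]
    ring
  have hE : 1 ≤ Real.exp (a ^ 2 / 8) := Real.one_le_exp (by positivity)
  have hup : Real.exp (-u ^ 2 / 4) * Real.cosh (a * u / 2) - 1
      ≤ a ^ 2 * u ^ 2 / 8 * Real.exp (a ^ 2 / 8) := by
    have hc : Real.cosh (a * u / 2) ≤ Real.exp (a ^ 2 * u ^ 2 / 8) := by
      refine (Real.cosh_le_exp_half_sq _).trans_eq ?_
      ring_nf
    have h1 : Real.exp (-u ^ 2 / 4) ≤ 1 := Real.exp_le_one_iff.mpr (by nlinarith [sq_nonneg u])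
    have h2 : Real.exp (-u ^ 2 / 4) * Real.cosh (a * u / 2) ≤ Real.exp (a ^ 2 * u ^ 2 / 8) :=
      (mul_le_of_le_one_left (Real.cosh_pos _).le h1).trans hc
    have h3 : Real.exp (a ^ 2 * u ^ 2 / 8) - 1
        ≤ a ^ 2 * u ^ 2 / 8 * Real.exp (a ^ 2 * u ^ 2 / 8) := by
      have h4 := Real.add_one_le_exp (-(a ^ 2 * u ^ 2 / 8))
      have h5 : Real.exp (-(a ^ 2 * u ^ 2 / 8)) * Real.exp (a ^ 2 * u ^ 2 / 8) = 1 := by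
        rw [← Real.exp_add]; simp
      nlinarith [Real.exp_pos (a ^ 2 * u ^ 2 / 8)]
    have h6 : Real.exp (a ^ 2 * u ^ 2 / 8) ≤ Real.exp (a ^ 2 / 8) :=
      Real.exp_le_exp.mpr (by nlinarith [sq_nonneg a])
    have h7 : a ^ 2 * u ^ 2 / 8 * Real.exp (a ^ 2 * u ^ 2 / 8)
        ≤ a ^ 2 * u ^ 2 / 8 * Real.exp (a ^ 2 / 8) := by gcongr
    linarith
  have hlow : -(u ^ 2 / 4) ≤ Real.exp (-u ^ 2 / 4) * Real.cosh (a * u / 2) - 1 := by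
    have h1 := Real.add_one_le_exp (-u ^ 2 / 4)
    have h2 : Real.exp (-u ^ 2 / 4) ≤ Real.exp (-u ^ 2 / 4) * Real.cosh (a * u / 2) :=
      le_mul_of_one_le_right (Real.exp_pos _).le (Real.one_le_cosh _)
    linarith
  have habs : |Real.exp (-u ^ 2 / 4) * Real.cosh (a * u / 2) - 1|
      ≤ u ^ 2 * (1 + a ^ 2) * Real.exp (a ^ 2 / 8) := by
    have h0 : 0 ≤ a ^ 2 * u ^ 2 * Real.exp (a ^ 2 / 8) := by positivity
    have h1 : u ^ 2 ≤ u ^ 2 * Real.exp (a ^ 2 / 8) := le_mul_of_one_le_right (sq_nonneg u) hE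
    rw [abs_le]
    constructor <;> nlinarith [sq_nonneg u]
  have hsq : (1 + a ^ 2) ^ 2 * Real.exp (-a ^ 2 / 8) ≤ 256 := by
    have h1 : 1 + a ^ 2 ≤ 16 * Real.exp (a ^ 2 / 16) := by
      have := Real.add_one_le_exp (a ^ 2 / 16)
      linarith
    calc (1 + a ^ 2) ^ 2 * Real.exp (-a ^ 2 / 8)
        ≤ (16 * Real.exp (a ^ 2 / 16)) ^ 2 * Real.exp (-a ^ 2 / 8) := by gcongr
      _ = 256 * (Real.exp (a ^ 2 / 16) * Real.exp (a ^ 2 / 16) * Real.exp (-a ^ 2 / 8)) := by ring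
      _ = 256 := by
        rw [← Real.exp_add, ← Real.exp_add, show a ^ 2 / 16 + a ^ 2 / 16 + -a ^ 2 / 8 = 0 by ring]
        simp
  rw [hD, abs_mul, abs_of_pos (a := 2 * Real.exp (-a ^ 2 / 4)) (by positivity)]
  calc (1 + a ^ 2) * (2 * Real.exp (-a ^ 2 / 4)
        * |Real.exp (-u ^ 2 / 4) * Real.cosh (a * u / 2) - 1|)
      ≤ (1 + a ^ 2) * (2 * Real.exp (-a ^ 2 / 4)
        * (u ^ 2 * (1 + a ^ 2) * Real.exp (a ^ 2 / 8))) := by gcongr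
    _ = 2 * u ^ 2 * ((1 + a ^ 2) ^ 2 * (Real.exp (-a ^ 2 / 4) * Real.exp (a ^ 2 / 8))) := by ring
    _ = 2 * u ^ 2 * ((1 + a ^ 2) ^ 2 * Real.exp (-a ^ 2 / 8)) := by
      rw [← Real.exp_add]; ring_nf
    _ ≤ 2 * u ^ 2 * 256 := by gcongr
    _ = 512 * u ^ 2 := by ring

lemma integrable_exp_neg_sq_div_eight : Integrable fun v : ℝ => Real.exp (-v ^ 2 / 8) := by
  convert integrable_exp_neg_mul_sq (b := 1 / 8) (by norm_num) using 3
  ring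

lemma integral_exp_neg_sq_div_eight : ∫ v : ℝ, Real.exp (-v ^ 2 / 8) = √(8 * π) := by
  have h := integral_gaussian (1 / 8)
  rw [show π / (1 / 8) = 8 * π by ring] at h
  rw [← h]
  congr 1
  ext v
  ring_nf

/-- Away from the singularity, the weight `1 + a²` is distributed on `u` and `a - u`. -/
lemma weight_mul_exp_mul_inv_le {p r a v : ℝ} (u : ℝ) (hp : 0 < p)
    (huv : a ^ 2 ≤ 2 * u ^ 2 + 2 * v ^ 2) (hr : 1 ≤ r) (h : u ^ 2 + r ≤ 2 * p) :
    (a ^ 2 + r) * (Real.exp (-v ^ 2 / 4) * p⁻¹) ≤ 32 * Real.exp (-v ^ 2 / 8) := by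
  have h2 : a ^ 2 + r ≤ 4 * p * (1 + v ^ 2) := by
    nlinarith [sq_nonneg v, sq_nonneg u, mul_nonneg (sq_nonneg v) (sq_nonneg u),
      mul_nonneg (sq_nonneg v) (sub_nonneg.mpr h), mul_nonneg (sq_nonneg v) (sub_nonneg.mpr hr)]
  calc (a ^ 2 + r) * (Real.exp (-v ^ 2 / 4) * p⁻¹)
      ≤ 4 * p * (1 + v ^ 2) * (Real.exp (-v ^ 2 / 4) * p⁻¹) := by gcongr
    _ = 4 * ((1 + v ^ 2) * Real.exp (-v ^ 2 / 4)) := by field_simp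
    _ ≤ 4 * (8 * Real.exp (-v ^ 2 / 8)) := by
      gcongr 4 * ?_
      exact one_add_mul_exp_neg_le (v ^ 2)
    _ = 32 * Real.exp (-v ^ 2 / 8) := by ring

lemma integrable_exp_mul_d2E (a : ℝ) {s : ℝ} (hs : s ≠ 0) :
    Integrable fun u : ℝ => Real.exp (-(a - u) ^ 2 / 4) * d2E (u, s) := by
  refine (integrable_d2E_left hs).bdd_mul (c := 1) (by fun_prop) (ae_of_all _ fun u => ?_)
  rw [Real.norm_eq_abs, Real.abs_exp, Real.exp_le_one_iff]
  nlinarith [sq_nonneg (a - u)]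

lemma abs_integral_exp_mul_d2E_le_of_one_le (a : ℝ) {s : ℝ} (hs : 1 ≤ s ^ 2) :
    (a ^ 2 + s ^ 2 + 1) * |∫ u : ℝ, Real.exp (-(a - u) ^ 2 / 4) * d2E (u, s)|
      ≤ 32 * √(8 * π) := by
  have hA : 0 < a ^ 2 + s ^ 2 + 1 := by positivity
  rw [← abs_of_pos hA, ← abs_mul, ← integral_const_mul, ← integral_exp_neg_sq_div_eight,
    ← integral_sub_left_eq_self (fun v => Real.exp (-v ^ 2 / 8)) volume a, ← integral_const_mul,
    ← Real.norm_eq_abs]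
  refine norm_integral_le_of_norm_le
    ((integrable_exp_neg_sq_div_eight.comp_sub_left a).const_mul 32) (ae_of_all _ fun u => ?_)
  rw [Real.norm_eq_abs, abs_mul, abs_mul, abs_of_pos hA, Real.abs_exp, add_assoc]
  calc (a ^ 2 + (s ^ 2 + 1)) * (Real.exp (-(a - u) ^ 2 / 4) * |d2E (u, s)|)
      ≤ (a ^ 2 + (s ^ 2 + 1)) * (Real.exp (-(a - u) ^ 2 / 4) * (u ^ 2 + s ^ 2)⁻¹) := by
        gcongr
        exact abs_d2E_le u s
    _ ≤ 32 * Real.exp (-(a - u) ^ 2 / 8) :=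
        weight_mul_exp_mul_inv_le u (by positivity) (by nlinarith [sq_nonneg (a - 2 * u)])
          (by linarith) (by nlinarith [sq_nonneg u])

lemma second_difference_mul_d2E_le (a s u : ℝ) :
    (1 + a ^ 2) * |(Real.exp (-(a - u) ^ 2 / 4) + Real.exp (-(a + u) ^ 2 / 4)
      - 2 * Real.exp (-a ^ 2 / 4)) * d2E (u, s)|
      ≤ 1024 * (1 + u ^ 2)⁻¹ + 32 * Real.exp (-(a - u) ^ 2 / 8)
        + 32 * Real.exp (-(a + u) ^ 2 / 8) := by
  rcases eq_or_ne u 0 with rfl | hu0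
  · have h : Real.exp (-(a - 0) ^ 2 / 4) + Real.exp (-(a + 0) ^ 2 / 4)
        - 2 * Real.exp (-a ^ 2 / 4) = 0 := by
      simp only [sub_zero, add_zero]; ring
    rw [h]
    simp only [zero_mul, abs_zero, mul_zero]
    positivity
  have hu2 : 0 < u ^ 2 := by positivity
  have hk : |d2E (u, s)| ≤ (u ^ 2)⁻¹ :=
    (abs_d2E_le u s).trans (inv_anti₀ hu2 (by nlinarith [sq_nonneg s]))
  rw [abs_mul, ← mul_assoc]
  rcases le_total (u ^ 2) 1 with hu | hu
  · calc _ ≤ 512 * u ^ 2 * (u ^ 2)⁻¹ :=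
          mul_le_mul (abs_exp_second_difference_le a hu) hk (abs_nonneg _) (by positivity)
      _ = 512 := by field_simp
      _ ≤ 1024 * (1 + u ^ 2)⁻¹ := by
          rw [← div_eq_mul_inv, le_div_iff₀ (by positivity)]
          linarith
      _ ≤ _ := by
          rw [add_assoc]
          exact le_add_of_nonneg_right (by positivity)
  · have h1 : |Real.exp (-(a - u) ^ 2 / 4) + Real.exp (-(a + u) ^ 2 / 4)
        - 2 * Real.exp (-a ^ 2 / 4)| ≤ Real.exp (-(a - u) ^ 2 / 4) + Real.exp (-(a + u) ^ 2 / 4)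
        + 2 * Real.exp (-a ^ 2 / 4) := by
      have := Real.exp_pos (-(a - u) ^ 2 / 4)
      have := Real.exp_pos (-(a + u) ^ 2 / 4)
      have := Real.exp_pos (-a ^ 2 / 4)
      rw [abs_le]
      constructor <;> linarith
    have h2 : (a ^ 2 + 1) * (Real.exp (-(a - u) ^ 2 / 4) * (u ^ 2)⁻¹)
        ≤ 32 * Real.exp (-(a - u) ^ 2 / 8) :=
      weight_mul_exp_mul_inv_le u hu2 (by nlinarith [sq_nonneg (a - 2 * u)])
        le_rfl (by linarith)
    have h3 : (a ^ 2 + 1) * (Real.exp (-(a + u) ^ 2 / 4) * (u ^ 2)⁻¹)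
        ≤ 32 * Real.exp (-(a + u) ^ 2 / 8) :=
      weight_mul_exp_mul_inv_le u hu2 (by nlinarith [sq_nonneg (a + 2 * u)])
        le_rfl (by linarith)
    have h4 : (a ^ 2 + 1) * Real.exp (-a ^ 2 / 4) ≤ 8 := by
      have h5 := one_add_mul_exp_neg_le (a ^ 2)
      have h6 : Real.exp (-a ^ 2 / 8) ≤ 1 := Real.exp_le_one_iff.mpr (by nlinarith [sq_nonneg a])
      linarith
    have h7 : (u ^ 2)⁻¹ ≤ 2 * (1 + u ^ 2)⁻¹ := by
      rw [← div_eq_mul_inv, le_div_iff₀ (by positivity), inv_mul_le_iff₀ hu2]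
      linarith
    have h8 : (a ^ 2 + 1) * Real.exp (-a ^ 2 / 4) * (u ^ 2)⁻¹ ≤ 8 * (2 * (1 + u ^ 2)⁻¹) := by
      gcongr
    have h9 : 0 < (1 + u ^ 2)⁻¹ := by positivity
    calc _ ≤ (1 + a ^ 2) * (Real.exp (-(a - u) ^ 2 / 4) + Real.exp (-(a + u) ^ 2 / 4)
            + 2 * Real.exp (-a ^ 2 / 4)) * (u ^ 2)⁻¹ := by gcongr
      _ = (a ^ 2 + 1) * (Real.exp (-(a - u) ^ 2 / 4) * (u ^ 2)⁻¹)
          + (a ^ 2 + 1) * (Real.exp (-(a + u) ^ 2 / 4) * (u ^ 2)⁻¹)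
          + 2 * ((a ^ 2 + 1) * Real.exp (-a ^ 2 / 4) * (u ^ 2)⁻¹) := by ring
      _ ≤ _ := by linarith

lemma abs_integral_exp_mul_d2E_le (a : ℝ) {s : ℝ} (hs : s ≠ 0) :
    (1 + a ^ 2) * |∫ u : ℝ, Real.exp (-(a - u) ^ 2 / 4) * d2E (u, s)|
      ≤ 512 * π + 32 * √(8 * π) := by
  have hA : 0 < 1 + a ^ 2 := by positivity
  have hprod := integrable_exp_mul_d2E a hs
  have hswap : ∀ u : ℝ, Real.exp (-(a + u) ^ 2 / 4) * d2E (u, s)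
      = Real.exp (-(a - -u) ^ 2 / 4) * d2E (-u, s) := fun u => by
    rw [d2E_neg_left, sub_neg_eq_add]
  have hprod_refl : Integrable fun u : ℝ => Real.exp (-(a + u) ^ 2 / 4) * d2E (u, s) := by
    simp_rw [hswap]
    exact hprod.comp_neg
  have hrefl : ∫ u : ℝ, Real.exp (-(a + u) ^ 2 / 4) * d2E (u, s)
      = ∫ u : ℝ, Real.exp (-(a - u) ^ 2 / 4) * d2E (u, s) := by
    simp_rw [hswap]
    exact integral_neg_eq_self (fun u => Real.exp (-(a - u) ^ 2 / 4) * d2E (u, s)) volume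
  have hsym : ∫ u : ℝ, (Real.exp (-(a - u) ^ 2 / 4) + Real.exp (-(a + u) ^ 2 / 4)
      - 2 * Real.exp (-a ^ 2 / 4)) * d2E (u, s)
      = 2 * ∫ u : ℝ, Real.exp (-(a - u) ^ 2 / 4) * d2E (u, s) := by
    simp_rw [sub_mul, add_mul]
    rw [integral_sub (by exact hprod.add hprod_refl) ((integrable_d2E_left hs).const_mul _),
      integral_add hprod hprod_refl, hrefl, integral_const_mul, integral_d2E_left hs]
    ring
  have hB1 : Integrable fun u : ℝ => 1024 * (1 + u ^ 2)⁻¹ :=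
    integrable_inv_one_add_sq.const_mul 1024
  have hB2 : Integrable fun u : ℝ => 32 * Real.exp (-(a - u) ^ 2 / 8) :=
    (integrable_exp_neg_sq_div_eight.comp_sub_left a).const_mul 32
  have hB3 : Integrable fun u : ℝ => 32 * Real.exp (-(a + u) ^ 2 / 8) :=
    (integrable_exp_neg_sq_div_eight.comp_add_left a).const_mul 32
  have hbound := norm_integral_le_of_norm_le ((hB1.add hB2).add hB3)
    (f := fun u => (1 + a ^ 2) * ((Real.exp (-(a - u) ^ 2 / 4) + Real.exp (-(a + u) ^ 2 / 4)
      - 2 * Real.exp (-a ^ 2 / 4)) * d2E (u, s))) (ae_of_all _ fun u => by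
        rw [Real.norm_eq_abs, abs_mul, abs_of_pos hA]
        exact second_difference_mul_d2E_le a s u)
  have hval : ∫ u : ℝ, (1024 * (1 + u ^ 2)⁻¹ + 32 * Real.exp (-(a - u) ^ 2 / 8)
      + 32 * Real.exp (-(a + u) ^ 2 / 8)) = 1024 * π + 64 * √(8 * π) := by
    have e1 := integral_sub_left_eq_self (fun v => Real.exp (-v ^ 2 / 8)) volume a
    have e2 := integral_add_left_eq_self (μ := volume) (fun v => Real.exp (-v ^ 2 / 8)) a
    rw [integral_add (by exact hB1.add hB2) hB3, integral_add hB1 hB2, integral_const_mul,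
      integral_const_mul, integral_const_mul, e1, e2, integral_univ_inv_one_add_sq,
      integral_exp_neg_sq_div_eight]
    ring
  rw [integral_const_mul, hsym, Real.norm_eq_abs, abs_mul, abs_mul, abs_of_pos hA] at hbound
  have hbound' := hbound.trans_eq hval
  rw [abs_two] at hbound'
  linarith

lemma exists_abs_integral_exp_mul_d2E_le :
    ∃ C > (0 : ℝ), ∀ a s : ℝ, s ≠ 0 →
      |∫ u : ℝ, Real.exp (-(a - u) ^ 2 / 4) * d2E (u, s)| ≤ C / (a ^ 2 + s ^ 2 + 1) := by
  refine ⟨2 * (512 * π + 32 * √(8 * π)), by positivity, fun a s hs => ?_⟩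
  rw [le_div_iff₀ (by positivity), mul_comm]
  have hpi := Real.pi_pos
  have hsqrt := Real.sqrt_nonneg (8 * π)
  rcases le_total 1 (s ^ 2) with h | h
  · have := abs_integral_exp_mul_d2E_le_of_one_le a h
    linarith
  · have h1 := abs_integral_exp_mul_d2E_le a hs
    have h2 := abs_nonneg (∫ u : ℝ, Real.exp (-(a - u) ^ 2 / 4) * d2E (u, s))
    nlinarith [sq_nonneg a]

lemma exists_abs_integral_exp_div_mul_d2E_le :
    ∃ C > (0 : ℝ), ∀ a s t : ℝ, s ≠ 0 → 0 < t →
      |∫ u : ℝ, Real.exp (-(a - u) ^ 2 / (4 * t)) * d2E (u, s)|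
        ≤ C * √t / (a ^ 2 + s ^ 2 + t) := by
  obtain ⟨C, hC, h⟩ := exists_abs_integral_exp_mul_d2E_le
  refine ⟨C, hC, fun a s t hs ht => ?_⟩
  obtain ⟨r, hr, rfl⟩ : ∃ r : ℝ, 0 < r ∧ r ^ 2 = t := ⟨√t, by positivity, Real.sq_sqrt ht.le⟩
  rw [Real.sqrt_sq hr.le]
  have hscale := Measure.integral_comp_mul_left
    (fun u : ℝ => Real.exp (-(a - u) ^ 2 / (4 * r ^ 2)) * d2E (u, s)) r
  have hpt : ∀ v : ℝ, Real.exp (-(a - r * v) ^ 2 / (4 * r ^ 2)) * d2E (r * v, s)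
      = (r ^ 2)⁻¹ * (Real.exp (-(a / r - v) ^ 2 / 4) * d2E (v, s / r)) := fun v => by
    have h1 : -(a - r * v) ^ 2 / (4 * r ^ 2) = -(a / r - v) ^ 2 / 4 := by
      field_simp
    have h2 : d2E (r * v, s) = (r ^ 2)⁻¹ * d2E (v, s / r) := by
      have h3 : s = r * (s / r) := by field_simp
      have h4 : s / r ≠ 0 := by positivity
      generalize s / r = σ at h3 h4
      subst h3
      unfold d2E
      dsimp only
      field_simp
    rw [h1, h2]
    ring
  simp_rw [hpt] at hscale
  rw [integral_const_mul, abs_of_pos (inv_pos.mpr hr), smul_eq_mul] at hscale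
  have hI : ∫ u : ℝ, Real.exp (-(a - u) ^ 2 / (4 * r ^ 2)) * d2E (u, s)
      = r⁻¹ * ∫ v : ℝ, Real.exp (-(a / r - v) ^ 2 / 4) * d2E (v, s / r) := by
    field_simp at hscale ⊢
    linarith
  rw [hI, abs_mul, abs_of_pos (inv_pos.mpr hr)]
  calc _ ≤ r⁻¹ * (C / ((a / r) ^ 2 + (s / r) ^ 2 + 1)) := by
        gcongr
        exact h _ _ (by positivity)
    _ = C * r / (a ^ 2 + s ^ 2 + r ^ 2) := by
        field_simp

lemma abs_heatK_le {x y : ℝ × ℝ} {t : ℝ} (hx : 0 < x.2) (hy : 0 < y.2) (ht : 0 < t) :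
    |heatK (x.1 - y.1, x.2 + y.2) t| ≤ 8 * Real.exp (-(1 / 8) * x.2 ^ 2 / t)
      / ((x.1 - y.1) ^ 2 + (x.2 + y.2) ^ 2 + t) := by
  unfold heatK
  dsimp only
  set Q := (x.1 - y.1) ^ 2 + (x.2 + y.2) ^ 2 with hQ
  have hQ0 : 0 ≤ Q := by positivity
  have hQx : x.2 ^ 2 ≤ Q := by nlinarith [sq_nonneg (x.1 - y.1)]
  rw [abs_of_pos (by positivity), le_div_iff₀ (by positivity)]
  have h1 := one_add_mul_exp_neg_le (Q / t)
  have h2 : -(Q / t) / 4 = -Q / (4 * t) := by field_simp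
  have h3 : Real.exp (-(Q / t) / 8) ≤ Real.exp (-(1 / 8) * x.2 ^ 2 / t) := by
    rw [Real.exp_le_exp, show -(Q / t) / 8 = (-(1 / 8) * Q) / t by ring]
    gcongr ?_ / t
    linarith
  rw [h2] at h1
  have h4 : (4 * π)⁻¹ ≤ 1 := inv_le_one_of_one_le₀ (by nlinarith [Real.pi_gt_three])
  calc (4 * π * t)⁻¹ * Real.exp (-Q / (4 * t)) * (Q + t)
      = (4 * π)⁻¹ * ((1 + Q / t) * Real.exp (-Q / (4 * t))) := by field_simp; ring
    _ ≤ 1 * (8 * Real.exp (-(1 / 8) * x.2 ^ 2 / t)) :=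
        mul_le_mul h4 (by linarith) (by positivity) zero_le_one
    _ = _ := one_mul _

/-- The Gaussian in the vertical variable moves the weight from `ζ - η` to `ξ + η`. -/
lemma exp_div_le_exp_mul_exp_div {a ξ η ζ t : ℝ} (hξ : 0 ≤ ξ) (hζ : 0 ≤ ζ) (ht : 0 < t) :
    Real.exp (-(ξ + ζ) ^ 2 / (4 * t)) / (a ^ 2 + (ζ - η) ^ 2 + t)
      ≤ 16 * Real.exp (-(1 / 8) * ξ ^ 2 / t) / (a ^ 2 + (ξ + η) ^ 2 + t)
        * Real.exp (-(1 / (8 * t)) * ζ ^ 2) := by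
  set q := (ξ + ζ) ^ 2 / t with hq
  have hq0 : 0 ≤ q := by positivity
  have hqt : q * t = (ξ + ζ) ^ 2 := by rw [hq]; field_simp
  have h1 : a ^ 2 + (ξ + η) ^ 2 + t ≤ 2 * (a ^ 2 + (ζ - η) ^ 2 + t) * (1 + q) := by
    have h0 : 0 ≤ q * (a ^ 2 + (ζ - η) ^ 2) := by positivity
    nlinarith [sq_nonneg ((ξ + ζ) + (ζ - η)), sq_nonneg a]
  have h2 := one_add_mul_exp_neg_le q
  have h3 : -q / 4 = -(ξ + ζ) ^ 2 / (4 * t) := by rw [hq]; field_simp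
  have h4 : Real.exp (-q / 8)
      ≤ Real.exp (-(1 / 8) * ξ ^ 2 / t) * Real.exp (-(1 / (8 * t)) * ζ ^ 2) := by
    rw [← Real.exp_add, Real.exp_le_exp,
      show -q / 8 = -(1 / 8) * (ξ + ζ) ^ 2 / t by rw [hq]; ring,
      show -(1 / 8) * ξ ^ 2 / t + -(1 / (8 * t)) * ζ ^ 2
        = -(1 / 8) * (ξ ^ 2 + ζ ^ 2) / t by field_simp; ring]
    gcongr ?_ / t
    nlinarith [mul_nonneg hξ hζ]
  rw [h3] at h2
  rw [div_mul_eq_mul_div, div_le_div_iff₀ (by positivity) (by positivity)]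
  calc Real.exp (-(ξ + ζ) ^ 2 / (4 * t)) * (a ^ 2 + (ξ + η) ^ 2 + t)
      ≤ Real.exp (-(ξ + ζ) ^ 2 / (4 * t)) * (2 * (a ^ 2 + (ζ - η) ^ 2 + t) * (1 + q)) := by
        gcongr
    _ = 2 * (a ^ 2 + (ζ - η) ^ 2 + t) * ((1 + q) * Real.exp (-(ξ + ζ) ^ 2 / (4 * t))) := by ring
    _ ≤ 2 * (a ^ 2 + (ζ - η) ^ 2 + t) * (8 * (Real.exp (-(1 / 8) * ξ ^ 2 / t)
        * Real.exp (-(1 / (8 * t)) * ζ ^ 2))) :=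
        mul_le_mul_of_nonneg_left (by linarith) (by positivity)
    _ = _ := by ring

lemma integral_heatK_mul_d2E (x y : ℝ × ℝ) (t ζ : ℝ) (ht : 0 < t) :
    ∫ z₁ : ℝ, heatK (x.1 - z₁, x.2 + ζ) t * d2E (z₁ - y.1, ζ - y.2)
      = (4 * π * t)⁻¹ * Real.exp (-(x.2 + ζ) ^ 2 / (4 * t))
        * ∫ u : ℝ, Real.exp (-((x.1 - y.1) - u) ^ 2 / (4 * t)) * d2E (u, ζ - y.2) := by
  rw [← integral_sub_right_eq_self
    (fun u => Real.exp (-((x.1 - y.1) - u) ^ 2 / (4 * t)) * d2E (u, ζ - y.2)) y.1,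
    ← integral_const_mul]
  congr 1
  ext z
  have h : Real.exp (-((x.1 - z) ^ 2 + (x.2 + ζ) ^ 2) / (4 * t))
      = Real.exp (-(x.2 + ζ) ^ 2 / (4 * t))
        * Real.exp (-((x.1 - y.1) - (z - y.1)) ^ 2 / (4 * t)) := by
    rw [← Real.exp_add]
    congr 1
    field_simp
    ring
  unfold heatK
  dsimp only
  rw [h]
  ring

/-- the pointwise Gaussian bound
|W*(x,y,t)| ≤ C e^{−c x₂²/t}/(|x−y*|² + t) for x,y ∈ ℝ²₊, t > 0. -/
theorem Wstar_pointwise_bound :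
    ∃ C > (0:ℝ), ∃ c > (0:ℝ), ∀ x ∈ upperHalf, ∀ y ∈ upperHalf, ∀ t > (0:ℝ),
      |Wstar x y t| ≤ C * Real.exp (-c * x.2 ^ 2 / t)
          / ((x.1 - y.1) ^ 2 + (x.2 + y.2) ^ 2 + t) := by
  obtain ⟨C, hC, hK⟩ := exists_abs_integral_exp_div_mul_d2E_le
  refine ⟨8 + 16 * C * √(8 * π) / π, by positivity, 1 / 8, by norm_num,
    fun x hx y hy t ht => ?_⟩
  replace hx : 0 < x.2 := hx
  replace hy : 0 < y.2 := hy
  set M := 16 * Real.exp (-(1 / 8) * x.2 ^ 2 / t) / ((x.1 - y.1) ^ 2 + (x.2 + y.2) ^ 2 + t)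
    with hM
  have hM0 : 0 < M := by positivity
  have hb : 0 < 1 / (8 * t) := by positivity
  have hgauss := (integrable_exp_neg_mul_sq hb).const_mul ((4 * π * t)⁻¹ * (C * √t) * M)
  have hinner : ∀ ζ : ℝ, 0 ≤ ζ → ζ ≠ y.2 →
      |∫ z₁ : ℝ, heatK (x.1 - z₁, x.2 + ζ) t * d2E (z₁ - y.1, ζ - y.2)|
        ≤ (4 * π * t)⁻¹ * (C * √t) * M * Real.exp (-(1 / (8 * t)) * ζ ^ 2) := by
    intro ζ hζ hζy
    rw [integral_heatK_mul_d2E x y t ζ ht, abs_mul, abs_of_pos (a := _ * Real.exp _) (by positivity)]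
    calc _ ≤ (4 * π * t)⁻¹ * Real.exp (-(x.2 + ζ) ^ 2 / (4 * t))
          * (C * √t / ((x.1 - y.1) ^ 2 + (ζ - y.2) ^ 2 + t)) := by
          gcongr
          exact hK _ _ _ (sub_ne_zero.mpr hζy) ht
      _ = (4 * π * t)⁻¹ * (C * √t) * (Real.exp (-(x.2 + ζ) ^ 2 / (4 * t))
          / ((x.1 - y.1) ^ 2 + (ζ - y.2) ^ 2 + t)) := by ring
      _ ≤ (4 * π * t)⁻¹ * (C * √t) * (M * Real.exp (-(1 / (8 * t)) * ζ ^ 2)) := by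
          gcongr
          exact exp_div_le_exp_mul_exp_div hx.le hζ ht
      _ = _ := by ring
  have houter : |∫ z₂ in (0:ℝ)..y.2, ∫ z₁ : ℝ,
      heatK (x.1 - z₁, x.2 + z₂) t * d2E (z₁ - y.1, z₂ - y.2)|
      ≤ (4 * π)⁻¹ * C * √(8 * π) * M := by
    rw [intervalIntegral.integral_of_le hy.le, ← Real.norm_eq_abs]
    have hae : ∀ᵐ ζ ∂(volume.restrict (Set.Ioc 0 y.2)), ζ ≠ y.2 :=
      ae_restrict_of_ae (Measure.ae_ne volume y.2)
    refine (norm_integral_le_of_norm_le hgauss.integrableOn ?_).trans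
      ((setIntegral_le_integral hgauss (ae_of_all _ fun ζ => ?_)).trans_eq ?_)
    · filter_upwards [hae, ae_restrict_mem measurableSet_Ioc] with ζ h1 h2
      exact hinner ζ h2.1.le h1
    · simp only [Pi.zero_apply]
      positivity
    · rw [integral_const_mul, integral_gaussian, show π / (1 / (8 * t)) = 8 * π * t by field_simp,
        Real.sqrt_mul (by positivity) t]
      have := Real.mul_self_sqrt ht.le
      calc (4 * π * t)⁻¹ * (C * √t) * M * (√(8 * π) * √t)
          = (4 * π * t)⁻¹ * C * M * √(8 * π) * (√t * √t) := by ring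
        _ = _ := by
          rw [this]
          field_simp
  have hfirst := abs_heatK_le hx hy ht
  unfold Wstar
  refine (abs_add_le _ _).trans ?_
  rw [abs_mul, abs_of_pos (a := (4 : ℝ)) (by norm_num)]
  refine (add_le_add hfirst (mul_le_mul_of_nonneg_left houter (by norm_num))).trans_eq ?_
  rw [hM]
  field_simp

end
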